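/- Let m > 1 be an even natural number, let l(m) = m · ∏_{p prime, p ∣ m} p^{⌊log_p m⌋}, and let k be a natural number with m + k ≤ l(m) − 1. Then C(m + k, m) ≡ C(l(m) − 1 − k, m) (mod m). -/

import Mathlib

theorem aux_dvd (m : ℕ) (hm : 1 < m)
    (l : ℕ) (hl : l = m * ∏ p ∈ m.primeFactors, p ^ Nat.log p m)
    (j : ℕ) (hj : 0 < j) (hjm : j ≤ m) : m ∣ l.choose j := by
  by_cases hC : l.choose j = 0
  · simp [hC]
  have hP : (∏ p ∈ m.primeFactors, p ^ Nat.log p m) ≠ 0 :=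
    Finset.prod_ne_zero_iff.2 fun p hp => pow_ne_zero _ (Nat.prime_of_mem_primeFactors hp).ne_zero
  have hl0 : l ≠ 0 := by rw [hl]; exact mul_ne_zero (by omega) hP
  have hd : l ∣ l.choose j * j := by
    obtain ⟨a, rfl⟩ := Nat.exists_eq_succ_of_ne_zero hl0
    obtain ⟨b, rfl⟩ := Nat.exists_eq_succ_of_ne_zero hj.ne'
    exact ⟨_, (Nat.add_one_mul_choose_eq a b).symm⟩
  rw [← Nat.factorization_prime_le_iff_dvd (by omega) hC]
  intro p hp
  by_cases hpm : p ∣ m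
  · have h1 := (Nat.factorization_prime_le_iff_dvd hl0 (mul_ne_zero hC hj.ne')).2 hd p hp
    rw [hl, Nat.factorization_mul (by omega) hP, ← hl, Nat.factorization_mul hC hj.ne'] at h1
    simp only [Finsupp.add_apply] at h1
    have h2 : Nat.log p m ≤ (∏ p ∈ m.primeFactors, p ^ Nat.log p m).factorization p := by
      rw [← hp.pow_dvd_iff_le_factorization hP]
      exact Finset.dvd_prod_of_mem (fun p => p ^ Nat.log p m)
        (Nat.mem_primeFactors.2 ⟨hp, hpm, by omega⟩)
    have h3 : j.factorization p ≤ Nat.log p m :=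
      Nat.le_log_of_pow_le hp.one_lt
        ((Nat.le_of_dvd hj (Nat.ordProj_dvd j p)).trans hjm)
    omega
  · simp [Nat.factorization_eq_zero_of_not_dvd hpm]

theorem choose_reflect_modEq_of_even
    (m : ℕ) (hm : 1 < m) (hme : Even m)
    (l : ℕ) (hl : l = m * ∏ p ∈ m.primeFactors, p ^ Nat.log p m)
    (k : ℕ) (hk : m + k ≤ l - 1) :
    (m + k).choose m ≡ (l - 1 - k).choose m [MOD m] := by
  have e1 : Ring.choose (-((k : ℤ) + 1)) m = ((m + k).choose m : ℕ) := by
    rw [Ring.choose_neg, Int.negOnePow_even _ (by exact_mod_cast hme), one_smul,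
      ← Ring.choose_natCast (R := ℤ)]
    congr 1
    push_cast
    ring
  have e2 : (((l - 1 - k).choose m : ℕ) : ℤ) = Ring.choose ((l : ℤ) + -((k : ℤ) + 1)) m := by
    rw [← Ring.choose_natCast (R := ℤ)]
    congr 1
    omega
  rw [← Int.natCast_modEq_iff, e2, Ring.add_choose_eq m (Commute.all _ _), ← e1,
    Int.modEq_iff_dvd, Finset.Nat.sum_antidiagonal_eq_sum_range_succ_mk,
    Finset.sum_range_succ']
  simp only [Ring.choose_zero_right, one_mul, Nat.sub_zero, add_sub_cancel_right]
  refine Finset.dvd_sum fun i hi => Dvd.dvd.mul_right ?_ _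
  rw [Ring.choose_natCast]
  have := Finset.mem_range.1 hi
  exact_mod_cast aux_dvd m hm l hl (i + 1) (by omega) (by omega)
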